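/- arXiv:1512.01638 — 2 statements merged into one kernel-verified Lean document; each statement's English description precedes it below -/
import Mathlib

section
/- Let γ ∈ [−3,−2). For every v ∈ ℝ³ with v ≠ 0 one has: (i) ā(v)·v = ℓ₁(v)·v; (ii) for every ξ ∈ ℝ³ with ξ·v = 0, ā(v)·ξ = ℓ₂(v)·ξ; (iii) ℓ₁(v) > 0 and ℓ₂(v) > 0; and (iv) as |v| → ∞, ℓ₁(v)/(2⟨v⟩^γ) → 1 and ℓ₂(v)/⟨v⟩^{γ+2} → 1. -/
noncomputable section

open MeasureTheory Real Filter

abbrev V3 := EuclideanSpace ℝ (Fin 3)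

/-- Japanese bracket ⟨v⟩ = (1+|v|²)^{1/2}. -/
def jap (v : V3) : ℝ := Real.sqrt (1 + ‖v‖ ^ 2)

/-- Standard Gaussian μ on ℝ³. -/
def gaussM (v : V3) : ℝ := (2 * Real.pi) ^ (-(3 : ℝ) / 2) * Real.exp (-‖v‖ ^ 2 / 2)

/-- Landau kernel matrix a_{ij}(z). -/
def aker (γ : ℝ) (z : V3) (i j : Fin 3) : ℝ :=
  ‖z‖ ^ (γ + 2) * ((if i = j then (1 : ℝ) else 0) - z i * z j / ‖z‖ ^ 2)

/-- ā_{ij} = a_{ij} * μ. -/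
def abar (γ : ℝ) (v : V3) (i j : Fin 3) : ℝ := ∫ w : V3, aker γ (v - w) i j * gaussM w

def bker (γ : ℝ) (z : V3) (i : Fin 3) : ℝ := -2 * ‖z‖ ^ γ * z i

/-- b̄_i = b_i * μ. -/
def bbar (γ : ℝ) (v : V3) (i : Fin 3) : ℝ := ∫ w : V3, bker γ (v - w) i * gaussM w

/-- J_β(v) = ∫ |v−w|^β μ(w) dw. -/
def Jfun (β : ℝ) (v : V3) : ℝ := ∫ w : V3, ‖v - w‖ ^ β * gaussM w

/-- c̄(v) = −2(γ+3) J_γ(v). -/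
def cbar (γ : ℝ) (v : V3) : ℝ := -2 * (γ + 3) * Jfun γ v

/-- ℓ₁(v). -/
def ell1 (γ : ℝ) (v : V3) : ℝ :=
  ∫ w : V3, (1 - ((∑ i, v i * w i) / (‖v‖ * ‖w‖)) ^ 2) * ‖w‖ ^ (γ + 2) * gaussM (v - w)

/-- Squared Euclidean norm of the cross product of two vectors in ℝ³. -/
def crossSq (a b : V3) : ℝ :=
  ∑ i, (crossProduct (R := ℝ) (fun k => a k) (fun k => b k) i) ^ 2

/-- ℓ₂(v). -/
def ell2 (γ : ℝ) (v : V3) : ℝ :=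
  ∫ w : V3,
    (1 - (1 / 2) * crossSq (‖v‖⁻¹ • v) (‖w‖⁻¹ • w)) * ‖w‖ ^ (γ + 2) * gaussM (v - w)

/-- Projection P_v ξ on the direction v. -/
def Pv (v ξ : V3) : V3 := ((∑ i, ξ i * v i) / ‖v‖ ^ 2) • v

/-- Partial derivative in the i-th coordinate direction. -/
def pd (i : Fin 3) (f : V3 → ℝ) : V3 → ℝ := fun v => fderiv ℝ f v (EuclideanSpace.single i 1)

/-- Anisotropic gradient ∇̃f = P_v ∇f + ⟨v⟩ (I − P_v) ∇f. -/
def anisoGrad (f : V3 → ℝ) (v : V3) : V3 :=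
  Pv v (gradient f v) + jap v • (gradient f v - Pv v (gradient f v))

/-- The filter |v| → ∞ on ℝ³. -/
def normAtTop : Filter V3 := Filter.comap (fun v : V3 => ‖v‖) Filter.atTop

open scoped RealInnerProductSpace

/-- Near the origin, `‖·‖ ^ q` is integrable on `ℝ³` for `q > -3`. -/
lemma integrable_indicator_norm_rpow {q : ℝ} (hq : -3 < q) :
    Integrable (fun z : V3 => (Metric.ball (0 : V3) 1).indicator (fun z => ‖z‖ ^ q) z) := by
  rw [integrable_indicator_iff measurableSet_ball]
  refine integrableOn_ball_of_norm_le_rpow (C := 1) (α := -q) (by simp) ?_ ?_ ?_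
  · simp only [finrank_euclideanSpace, Fintype.card_fin, Nat.cast_ofNat]
    linarith
  · refine ae_of_all _ fun x => ?_
    rw [neg_neg, one_mul, Real.norm_of_nonneg (by positivity)]
  · exact Measurable.aestronglyMeasurable (by fun_prop)

lemma integrable_exp_neg_mul_norm_sq {b : ℝ} (hb : 0 < b) :
    Integrable (fun u : V3 => Real.exp (-b * ‖u‖ ^ 2)) := by
  have h := GaussianFourier.integrable_cexp_neg_mul_sq_norm_add (V := V3) (b := (b : ℂ))
    (by simpa using hb) 0 0
  refine h.norm.congr (ae_of_all _ fun u => ?_)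
  simp only [Complex.norm_exp]
  congr 1
  norm_cast
  simp [-Complex.ofReal_pow]

lemma norm_rpow_le_indicator_add_one {q : ℝ} (hq : q ≤ 0) (z : V3) :
    ‖z‖ ^ q ≤ (Metric.ball (0 : V3) 1).indicator (fun z => ‖z‖ ^ q) z + 1 := by
  by_cases hz : z ∈ Metric.ball (0 : V3) 1
  · rw [Set.indicator_of_mem hz]
    linarith
  · rw [Set.indicator_of_notMem hz, zero_add]
    refine Real.rpow_le_one_of_one_le_of_nonpos ?_ hq
    simpa using hz

/-- Singular potentials of a Gaussian are finite, uniformly in the base point. -/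
lemma exists_integral_norm_rpow_mul_exp_le {q b : ℝ} (hq : -3 < q) (hq0 : q ≤ 0) (hb : 0 < b) :
    ∃ K : ℝ, ∀ v : V3, Integrable (fun u : V3 => ‖v - u‖ ^ q * Real.exp (-b * ‖u‖ ^ 2)) ∧
      ∫ u : V3, ‖v - u‖ ^ q * Real.exp (-b * ‖u‖ ^ 2) ≤ K := by
  set g : V3 → ℝ := fun z => (Metric.ball (0 : V3) 1).indicator (fun z => ‖z‖ ^ q) z
  have hgi : Integrable g := integrable_indicator_norm_rpow hq
  have hg0 : ∀ z, 0 ≤ g z := fun z => Set.indicator_nonneg (fun _ _ => by positivity) z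
  have hei := integrable_exp_neg_mul_norm_sq hb
  refine ⟨(∫ z, g z) + ∫ u : V3, Real.exp (-b * ‖u‖ ^ 2), fun v => ?_⟩
  have hsum : Integrable (fun u : V3 => g (v - u) + Real.exp (-b * ‖u‖ ^ 2)) :=
    (hgi.comp_sub_left v).add hei
  have hle : ∀ u : V3, ‖v - u‖ ^ q * Real.exp (-b * ‖u‖ ^ 2) ≤
      g (v - u) + Real.exp (-b * ‖u‖ ^ 2) := by
    intro u
    have h1 : Real.exp (-b * ‖u‖ ^ 2) ≤ 1 := Real.exp_le_one_iff.2 (by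
      have := mul_nonneg hb.le (sq_nonneg ‖u‖)
      linarith)
    have h2 := norm_rpow_le_indicator_add_one hq0 (v - u)
    have h3 := hg0 (v - u)
    have h4 := Real.exp_pos (-b * ‖u‖ ^ 2)
    calc _ ≤ (g (v - u) + 1) * Real.exp (-b * ‖u‖ ^ 2) := by gcongr
      _ ≤ _ := by nlinarith
  have hint : Integrable (fun u : V3 => ‖v - u‖ ^ q * Real.exp (-b * ‖u‖ ^ 2)) := by
    refine hsum.mono' (Measurable.aestronglyMeasurable (by fun_prop)) (ae_of_all _ fun u => ?_)
    rw [Real.norm_of_nonneg (by positivity)]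
    exact hle u
  refine ⟨hint, (integral_mono hint hsum hle).trans_eq ?_⟩
  rw [integral_add (hgi.comp_sub_left v) hei, integral_sub_left_eq_self g volume v]

/-- Every nonzero vector of `ℝ³` spans the first axis of an orthonormal basis. -/
lemma exists_orthonormalBasis_zero_eq {v : V3} (hv : v ≠ 0) :
    ∃ b : OrthonormalBasis (Fin 3) ℝ V3, b 0 = ‖v‖⁻¹ • v := by
  have hvn : ‖v‖ ≠ 0 := norm_ne_zero_iff.2 hv
  obtain ⟨b, hb⟩ := Orthonormal.exists_orthonormalBasis_extension_of_card_eq (𝕜 := ℝ) (E := V3)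
    (ι := Fin 3) (by simp) (v := fun _ => ‖v‖⁻¹ • v) (s := {0}) (by
      rw [orthonormal_iff_ite]
      rintro ⟨i, hi⟩ ⟨j, hj⟩
      obtain rfl : i = 0 := hi
      obtain rfl : j = 0 := hj
      simp [Set.domRestrict, norm_smul, hvn])
  exact ⟨b, hb 0 rfl⟩

/-- Second moments of a weight that is invariant under the isometries fixing `v`. -/
lemma secondMoment_of_invariant {v : V3} (hv : v ≠ 0) {K : V3 → ℝ}
    (hinv : ∀ R : V3 ≃ₗᵢ[ℝ] V3, R v = v → ∀ w, K (R w) = K w)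
    (hint : ∀ x y : V3, Integrable (fun w : V3 => ⟪x, w⟫ * ⟪y, w⟫ * K w)) :
    (∀ x : V3, ∫ w : V3, ⟪x, w⟫ * ⟪v, w⟫ * K w =
      (∫ w : V3, ⟪v, w⟫ * ⟪v, w⟫ * K w) / ‖v‖ ^ 2 * ⟪x, v⟫) ∧
    ∀ ξ : V3, ⟪ξ, v⟫ = 0 → ∀ x : V3, ∫ w : V3, ⟪x, w⟫ * ⟪ξ, w⟫ * K w =
      (1 / 2) * ((∫ w : V3, ‖w‖ ^ 2 * K w) -
        (∫ w : V3, ⟪v, w⟫ * ⟪v, w⟫ * K w) / ‖v‖ ^ 2) * ⟪x, ξ⟫ := by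
  set M : V3 → V3 → ℝ := fun x y => ∫ w : V3, ⟪x, w⟫ * ⟪y, w⟫ * K w with hM
  have hMR : ∀ R : V3 ≃ₗᵢ[ℝ] V3, R v = v → ∀ x y, M (R x) (R y) = M x y := by
    intro R hR x y
    have h := R.measurePreserving.integral_comp R.toHomeomorph.measurableEmbedding
      (fun w : V3 => ⟪R x, w⟫ * ⟪R y, w⟫ * K w)
    simp only [LinearIsometryEquiv.inner_map_map, hinv R hR] at h
    exact h.symm
  have hvn : ‖v‖ ≠ 0 := norm_ne_zero_iff.2 hv
  obtain ⟨b, hb⟩ := exists_orthonormalBasis_zero_eq hv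
  have hvb : v = ‖v‖ • b 0 := by rw [hb, smul_smul, mul_inv_cancel₀ hvn, one_smul]
  have horth : ∀ i j, i ≠ j → ⟪b i, b j⟫ = 0 := fun i j h => by
    simp [b.inner_eq_ite, h]
  have hfix : ∀ z : V3, ⟪z, b 0⟫ = 0 → (ℝ ∙ z)ᗮ.reflection v = v := by
    intro z hz
    apply Submodule.reflection_mem_subspace_eq_self
    rw [Submodule.mem_orthogonal_singleton_iff_inner_right, hvb, real_inner_smul_right, hz,
      mul_zero]
  have hsymm : ∀ x y, M x y = M y x := fun x y => by
    simp only [hM]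
    congr 1
    ext w
    ring
  have hoff' : ∀ i j, i ≠ 0 → i ≠ j → M (b i) (b j) = 0 := by
    intro i j hi hij
    have h := hMR _ (hfix (b i) (horth i 0 hi)) (b i) (b j)
    rw [Submodule.reflection_orthogonalComplement_singleton_eq_neg,
      Submodule.reflection_mem_subspace_eq_self (x := b j)
        (Submodule.mem_orthogonal_singleton_iff_inner_right.2 (horth i j hij))] at h
    have : M (-b i) (b j) = -M (b i) (b j) := by
      simp only [hM, inner_neg_left, neg_mul, integral_neg]
    linarith
  have hoff : ∀ i j, i ≠ j → M (b i) (b j) = 0 := by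
    intro i j hij
    by_cases hi : i = 0
    · rw [hsymm]
      exact hoff' j i (fun h => hij (hi.trans h.symm)) hij.symm
    · exact hoff' i j hi hij
  have h12 : M (b 1) (b 1) = M (b 2) (b 2) := by
    have h := hMR _ (hfix (b 1 - b 2) (by
      rw [inner_sub_left, horth 1 0 (by decide), horth 2 0 (by decide), sub_zero])) (b 1) (b 1)
    rw [Submodule.reflection_sub (by simp)] at h
    exact h.symm
  have hexp : ∀ x y, M x y = ∑ i, M (b i) (b i) * (⟪x, b i⟫ * ⟪y, b i⟫) := by
    intro x y
    have h1 : M x y = ∑ i, ∑ j, ⟪x, b i⟫ * ⟪y, b j⟫ * M (b i) (b j) := by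
      simp only [hM, ← integral_const_mul]
      have hrow : ∀ i, ∑ j, ∫ w : V3, ⟪x, b i⟫ * ⟪y, b j⟫ * (⟪b i, w⟫ * ⟪b j, w⟫ * K w) =
          ∫ w : V3, ∑ j, ⟪x, b i⟫ * ⟪y, b j⟫ * (⟪b i, w⟫ * ⟪b j, w⟫ * K w) := fun i =>
        (integral_finsetSum _ fun j _ => (hint (b i) (b j)).const_mul _).symm
      simp_rw [hrow]
      rw [← integral_finsetSum _ (fun i _ => integrable_finsetSum _
        fun j _ => (hint (b i) (b j)).const_mul _)]
      congr 1
      ext w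
      rw [← b.sum_inner_mul_inner x w, ← b.sum_inner_mul_inner y w, Finset.sum_mul_sum,
        Finset.sum_mul]
      refine Finset.sum_congr rfl fun i _ => ?_
      rw [Finset.sum_mul]
      refine Finset.sum_congr rfl fun j _ => ?_
      ring
    rw [h1]
    refine Finset.sum_congr rfl fun i _ => ?_
    rw [Finset.sum_eq_single i (fun j _ hj => by rw [hoff i j hj.symm, mul_zero]) (by simp)]
    ring
  have htr : ∫ w : V3, ‖w‖ ^ 2 * K w = ∑ i, M (b i) (b i) := by
    simp only [hM]
    rw [← integral_finsetSum _ (fun i _ => hint (b i) (b i))]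
    congr 1
    ext w
    rw [← b.sum_sq_inner_right w, Finset.sum_mul]
    refine Finset.sum_congr rfl fun i _ => ?_
    ring
  have h0 : M v v / ‖v‖ ^ 2 = M (b 0) (b 0) := by
    have : M v v = ‖v‖ ^ 2 * M (b 0) (b 0) := by
      simp only [hM, ← integral_const_mul]
      congr 1
      ext w
      conv_lhs => rw [hvb]
      rw [real_inner_smul_left]
      ring
    rw [this]
    field_simp
  have hvi : ∀ i, i ≠ 0 → ⟪v, b i⟫ = 0 := fun i hi => by
    rw [hvb, real_inner_smul_left, horth 0 i hi.symm, mul_zero]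
  constructor
  · intro x
    change M x v = M v v / ‖v‖ ^ 2 * _
    rw [h0, hexp, ← b.sum_inner_mul_inner x v]
    simp only [Fin.sum_univ_three, real_inner_comm v, hvi 1 (by decide), hvi 2 (by decide)]
    ring
  · intro ξ hξ x
    change M x ξ = 1 / 2 * (_ - M v v / ‖v‖ ^ 2) * _
    have hξ0 : ⟪ξ, b 0⟫ = 0 := by
      rw [hb, real_inner_smul_right, hξ, mul_zero]
    rw [h0, htr, hexp, ← b.sum_inner_mul_inner x ξ]
    simp only [Fin.sum_univ_three, real_inner_comm ξ, hξ0, h12]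
    ring

/-- The Gaussian weight factors into one-dimensional standard Gaussian densities. -/
lemma gaussM_toLp (y : Fin 3 → ℝ) :
    gaussM (WithLp.toLp 2 y) = ∏ j, ProbabilityTheory.gaussianPDFReal 0 1 (y j) := by
  simp only [gaussM, ProbabilityTheory.gaussianPDFReal, Finset.prod_mul_distrib, ← Real.exp_sum,
    EuclideanSpace.real_norm_sq_eq, Finset.prod_const, Finset.card_univ, Fintype.card_fin,
    NNReal.coe_one, mul_one, sub_zero, ← Finset.sum_div, Finset.sum_neg_distrib]
  congr 1
  rw [Real.sqrt_eq_rpow, ← Real.rpow_neg (by positivity), ← Real.rpow_mul_natCast (by positivity)]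
  norm_num

/-- The coordinates of a standard Gaussian vector have unit variance. -/
lemma integral_inner_sq_mul_gaussM (b : OrthonormalBasis (Fin 3) ℝ V3) (i : Fin 3) :
    ∫ u : V3, ⟪b i, u⟫ ^ 2 * gaussM u = 1 := by
  rw [← b.measurePreserving_repr_symm.integral_comp b.repr.symm.toHomeomorph.measurableEmbedding,
    ← (PiLp.volume_preserving_toLp (Fin 3)).integral_comp
      (MeasurableEquiv.toLp 2 _).measurableEmbedding]
  have hpt : ∀ y : Fin 3 → ℝ, ⟪b i, b.repr.symm (WithLp.toLp 2 y)⟫ ^ 2 *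
      gaussM (b.repr.symm (WithLp.toLp 2 y)) =
      ∏ j, (if j = i then y j ^ 2 else 1) * ProbabilityTheory.gaussianPDFReal 0 1 (y j) := by
    intro y
    rw [Finset.prod_mul_distrib, Finset.prod_ite_eq' Finset.univ i, if_pos (Finset.mem_univ i),
      ← gaussM_toLp, ← b.repr_apply_apply, LinearIsometryEquiv.apply_symm_apply]
    simp only [gaussM, LinearIsometryEquiv.norm_map]
  simp_rw [hpt]
  rw [integral_fintype_prod_volume_eq_prod
    (fun j x => (if j = i then x ^ 2 else 1) * ProbabilityTheory.gaussianPDFReal 0 1 x)]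
  refine Finset.prod_eq_one fun j _ => ?_
  by_cases hj : j = i
  · have h := ProbabilityTheory.variance_id_gaussianReal (μ := 0) (v := 1)
    rw [ProbabilityTheory.variance_of_integral_eq_zero aemeasurable_id (by simp),
      ProbabilityTheory.integral_gaussianReal_eq_integral_smul one_ne_zero] at h
    simpa [hj, mul_comm] using h
  · simpa [hj] using ProbabilityTheory.integral_gaussianPDFReal_eq_one 0 one_ne_zero

lemma integral_gaussM : ∫ u : V3, gaussM u = 1 := by
  rw [← (PiLp.volume_preserving_toLp (Fin 3)).integral_comp
    (MeasurableEquiv.toLp 2 _).measurableEmbedding]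
  simp_rw [gaussM_toLp]
  rw [integral_fintype_prod_volume_eq_prod
    (fun _ : Fin 3 => ProbabilityTheory.gaussianPDFReal 0 1)]
  exact Finset.prod_eq_one fun _ _ =>
    ProbabilityTheory.integral_gaussianPDFReal_eq_one 0 one_ne_zero

lemma gaussM_nonneg (u : V3) : 0 ≤ gaussM u := by
  unfold gaussM
  positivity

lemma measurable_gaussM : Measurable gaussM := by
  unfold gaussM
  fun_prop

lemma norm_le_jap (v : V3) : ‖v‖ ≤ jap v :=
  Real.le_sqrt_of_sq_le (by linarith)

lemma jap_le_norm_add_one (v : V3) : jap v ≤ ‖v‖ + 1 :=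
  Real.sqrt_le_iff.2 ⟨by positivity, by nlinarith [norm_nonneg v]⟩

lemma jap_pos (v : V3) : 0 < jap v :=
  Real.sqrt_pos.2 (by positivity)

lemma jap_sq (v : V3) : jap v ^ 2 = 1 + ‖v‖ ^ 2 :=
  Real.sq_sqrt (by positivity)

lemma tendsto_norm_normAtTop : Tendsto (fun v : V3 => ‖v‖) normAtTop atTop :=
  tendsto_comap

lemma tendsto_jap_normAtTop : Tendsto jap normAtTop atTop :=
  tendsto_atTop_mono norm_le_jap tendsto_norm_normAtTop

lemma integrable_norm_pow_mul_gaussM (k : ℕ) :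
    Integrable (fun u : V3 => ‖u‖ ^ k * gaussM u) := by
  have h := (integrable_fun_norm_addHaar (volume : Measure V3)
    (f := fun y : ℝ => y ^ k * ((2 * Real.pi) ^ (-(3 : ℝ) / 2) * Real.exp (-y ^ 2 / 2)))).2 ?_
  · exact h
  have h2 := ((integrable_rpow_mul_exp_neg_mul_sq (b := 1 / 2) (by norm_num)
    (s := ((k + 2 : ℕ) : ℝ)) (by
      have : (0 : ℝ) ≤ ((k + 2 : ℕ) : ℝ) := Nat.cast_nonneg _
      linarith)).const_mul ((2 * Real.pi) ^ (-(3 : ℝ) / 2))).integrableOn (s := Set.Ioi 0)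
  refine h2.congr_fun (fun y _ => ?_) measurableSet_Ioi
  simp only [finrank_euclideanSpace, Fintype.card_fin, Real.rpow_natCast, smul_eq_mul]
  rw [show -(1 / 2) * y ^ 2 = -y ^ 2 / 2 by ring]
  ring

/-- Outside the ball of radius `‖v‖ / 2`, half of the Gaussian decay can be spent on `v`. -/
lemma gaussM_le_of_half_norm_le {u v : V3} (h : ‖v‖ / 2 ≤ ‖u‖) :
    gaussM u ≤ (2 * Real.pi) ^ (-(3 : ℝ) / 2) * Real.exp (-‖v‖ ^ 2 / 16) *
      Real.exp (-(1 / 4) * ‖u‖ ^ 2) := by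
  rw [gaussM, mul_assoc, ← Real.exp_add]
  gcongr
  nlinarith [norm_nonneg v]

/-- The ratio `‖v - u‖ / ⟨v⟩` is bounded below when `‖u‖ ≤ ‖v‖ / 2`. -/
lemma one_fourth_le_norm_sub_div_jap {u v : V3} (hv : 1 ≤ ‖v‖) (h : ‖u‖ ≤ ‖v‖ / 2) :
    1 / 4 ≤ ‖v - u‖ / jap v := by
  rw [le_div_iff₀ (jap_pos v)]
  linarith [jap_le_norm_add_one v, norm_sub_norm_le v u]

lemma tendsto_norm_sub_div_jap (u : V3) :
    Tendsto (fun v : V3 => ‖v - u‖ / jap v) normAtTop (nhds 1) := by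
  rw [tendsto_iff_norm_sub_tendsto_zero]
  have hlim : Tendsto (fun v : V3 => (‖u‖ + 1) / jap v) normAtTop (nhds 0) :=
    tendsto_jap_normAtTop.const_div_atTop _
  refine squeeze_zero (fun _ => norm_nonneg _) (fun v => ?_) hlim
  have hj := jap_pos v
  rw [div_sub_one hj.ne', norm_div, Real.norm_of_nonneg hj.le, Real.norm_eq_abs]
  gcongr
  rw [abs_le]
  constructor <;>
    linarith [norm_sub_norm_le v u, norm_sub_le v u, norm_le_jap v, jap_le_norm_add_one v]

/-- The relative error made by replacing `‖v - u‖` with `⟨v⟩` for `‖u‖ ≤ ‖v‖ / 2`, and by zero for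
the other `u`. -/
def relError (p : ℝ) (v u : V3) : ℝ :=
  |(if ‖u‖ ≤ ‖v‖ / 2 then (‖v - u‖ / jap v) ^ p else 0) - 1|

lemma measurable_relError (p : ℝ) (v : V3) : Measurable (relError p v) := by
  unfold relError
  have : MeasurableSet {u : V3 | ‖u‖ ≤ ‖v‖ / 2} := measurableSet_le (by fun_prop) (by fun_prop)
  have h2 : Measurable fun u : V3 => if ‖u‖ ≤ ‖v‖ / 2 then (‖v - u‖ / jap v) ^ p else 0 :=
    Measurable.ite this (by fun_prop) measurable_const
  exact (h2.sub_const 1).abs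

lemma relError_le {p : ℝ} (hp : p ≤ 0) {v : V3} (hv : 1 ≤ ‖v‖) (u : V3) :
    relError p v u ≤ (1 / 4) ^ p + 1 := by
  unfold relError
  refine (abs_sub _ _).trans ?_
  rw [abs_one]
  gcongr
  split_ifs with h
  · have h4 := one_fourth_le_norm_sub_div_jap hv h
    rw [abs_of_nonneg (Real.rpow_nonneg (by linarith) _)]
    exact Real.rpow_le_rpow_of_nonpos (by norm_num) h4 hp
  · rw [abs_zero]
    positivity

lemma tendsto_relError (p : ℝ) (u : V3) :
    Tendsto (fun v => relError p v u) normAtTop (nhds 0) := by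
  have h1 : Tendsto (fun v : V3 => |(‖v - u‖ / jap v) ^ p - 1|) normAtTop (nhds 0) := by
    have := (((tendsto_norm_sub_div_jap u).rpow_const (p := p) (Or.inl one_ne_zero)).sub_const
      1).abs
    simpa using this
  refine h1.congr' ?_
  filter_upwards [tendsto_norm_normAtTop.eventually_ge_atTop (2 * ‖u‖)] with v hv
  rw [relError, if_pos (by linarith)]

lemma integrable_norm_pow_mul_relError {p : ℝ} (hp : p ≤ 0) (k : ℕ) {v : V3} (hv : 1 ≤ ‖v‖) :
    Integrable (fun u : V3 => ‖u‖ ^ k * relError p v u * gaussM u) := by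
  refine ((integrable_norm_pow_mul_gaussM k).const_mul ((1 / 4) ^ p + 1)).mono'
    (Measurable.aestronglyMeasurable (((measurable_norm.pow_const k).mul
      (measurable_relError p v)).mul measurable_gaussM)) (ae_of_all _ fun u => ?_)
  have h := relError_le hp hv u
  have hg := gaussM_nonneg u
  have h0 : 0 ≤ relError p v u := abs_nonneg _
  rw [Real.norm_of_nonneg (by positivity)]
  calc _ = relError p v u * (‖u‖ ^ k * gaussM u) := by ring
    _ ≤ _ := by gcongr

lemma tendsto_integral_relError {p : ℝ} (hp : p ≤ 0) (k : ℕ) :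
    Tendsto (fun v : V3 => ∫ u : V3, ‖u‖ ^ k * relError p v u * gaussM u) normAtTop
      (nhds 0) := by
  have : normAtTop.IsCountablyGenerated := by
    unfold normAtTop
    infer_instance
  have h := tendsto_integral_filter_of_dominated_convergence (l := normAtTop) (μ := volume)
    (F := fun v u : V3 => ‖u‖ ^ k * relError p v u * gaussM u) (f := fun _ => (0 : ℝ))
    (fun u => ((1 / 4) ^ p + 1) * (‖u‖ ^ k * gaussM u)) ?_ ?_
    ((integrable_norm_pow_mul_gaussM k).const_mul _) ?_
  · simpa using h
  · exact Eventually.of_forall fun v => Measurable.aestronglyMeasurable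
      (((measurable_norm.pow_const k).mul (measurable_relError p v)).mul measurable_gaussM)
  · filter_upwards [tendsto_norm_normAtTop.eventually_ge_atTop 1] with v hv
    refine ae_of_all _ fun u => ?_
    have h := relError_le hp hv u
    have hg := gaussM_nonneg u
    have h0 : 0 ≤ relError p v u := abs_nonneg _
    rw [Real.norm_of_nonneg (by positivity)]
    calc _ = relError p v u * (‖u‖ ^ k * gaussM u) := by ring
      _ ≤ _ := by gcongr
  · refine ae_of_all _ fun u => ?_
    simpa using ((tendsto_relError p u).const_mul (‖u‖ ^ k)).mul_const (gaussM u)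

lemma tendsto_exp_neg_norm_sq_div_jap_rpow (p : ℝ) :
    Tendsto (fun v : V3 => Real.exp (-‖v‖ ^ 2 / 16) / jap v ^ p) normAtTop (nhds 0) := by
  have h1 : Tendsto (fun v : V3 => jap v ^ 2) normAtTop atTop :=
    (tendsto_pow_atTop two_ne_zero).comp tendsto_jap_normAtTop
  have h2 := ((tendsto_rpow_mul_exp_neg_mul_atTop_nhds_zero (-p / 2) (1 / 16)
    (by norm_num)).comp h1).const_mul (Real.exp (1 / 16))
  rw [mul_zero] at h2
  refine h2.congr fun v => ?_
  have hj := jap_pos v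
  simp only [Function.comp]
  rw [← Real.rpow_natCast (jap v) 2, ← Real.rpow_mul hj.le, Real.rpow_natCast, jap_sq,
    show -‖v‖ ^ 2 / 16 = 1 / 16 + -(1 / 16) * (1 + ‖v‖ ^ 2) by ring, Real.exp_add,
    show ((2 : ℕ) : ℝ) * (-p / 2) = -p by push_cast; ring, Real.rpow_neg hj.le]
  ring

lemma integrable_norm_sub_rpow_mul_gaussM {q : ℝ} (hq : -3 < q) (hq0 : q ≤ 0) (v : V3) :
    Integrable (fun u : V3 => ‖v - u‖ ^ q * gaussM u) := by
  obtain ⟨K, hK⟩ := exists_integral_norm_rpow_mul_exp_le hq hq0 (b := 1 / 2) (by norm_num)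
  refine ((hK v).1.const_mul ((2 * Real.pi) ^ (-(3 : ℝ) / 2))).congr (ae_of_all _ fun u => ?_)
  simp only [gaussM]
  rw [show -(1 / 2) * ‖u‖ ^ 2 = -‖u‖ ^ 2 / 2 by ring]
  ring

/-- Gaussian averages of a kernel `H v u = h v u * ‖v - u‖ ^ p` with an integrable singularity at
`u = v` behave like `⟨v⟩ ^ p` times the Gaussian average of `h`. -/
lemma tendsto_integral_div_jap_rpow_sub {q p : ℝ} (hq : -3 < q) (hq0 : q ≤ 0) (hp : p ≤ 0) (k : ℕ)
    {H h : V3 → V3 → ℝ} (hHm : ∀ v, Measurable (H v)) (hhm : ∀ v, Measurable (h v))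
    (hH0 : ∀ v u, 0 ≤ H v u) (hHq : ∀ v u, H v u ≤ ‖v - u‖ ^ q)
    (hh0 : ∀ v u, 0 ≤ h v u) (hhk : ∀ v u, h v u ≤ ‖u‖ ^ k)
    (hHh : ∀ v u, v ≠ 0 → v - u ≠ 0 → H v u = h v u * ‖v - u‖ ^ p) :
    Tendsto (fun v => (∫ u, H v u * gaussM u) / jap v ^ p - ∫ u, h v u * gaussM u)
      normAtTop (nhds 0) := by
  obtain ⟨K, hK⟩ := exists_integral_norm_rpow_mul_exp_le hq hq0 (b := 1 / 4) (by norm_num)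
  set c : ℝ := (2 * Real.pi) ^ (-(3 : ℝ) / 2)
  have hc0 : 0 < c := by positivity
  have hlim : Tendsto (fun v : V3 => (∫ u : V3, ‖u‖ ^ k * relError p v u * gaussM u) +
      c * (Real.exp (-‖v‖ ^ 2 / 16) / jap v ^ p) * K) normAtTop (nhds 0) := by
    simpa using (tendsto_integral_relError hp k).add
      (((tendsto_exp_neg_norm_sq_div_jap_rpow p).const_mul c).mul_const K)
  refine squeeze_zero_norm' ?_ hlim
  filter_upwards [tendsto_norm_normAtTop.eventually_ge_atTop 1] with v hv
  have hj := jap_pos v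
  have hv0 : v ≠ 0 := by
    rintro rfl
    simp at hv
    linarith
  have hHi : Integrable fun u => H v u * gaussM u := by
    refine (integrable_norm_sub_rpow_mul_gaussM hq hq0 v).mono'
      ((hHm v).mul measurable_gaussM).aestronglyMeasurable (ae_of_all _ fun u => ?_)
    rw [Real.norm_of_nonneg (mul_nonneg (hH0 v u) (gaussM_nonneg u))]
    exact mul_le_mul_of_nonneg_right (hHq v u) (gaussM_nonneg u)
  have hhi : Integrable fun u => h v u * gaussM u := by
    refine (integrable_norm_pow_mul_gaussM k).mono'
      ((hhm v).mul measurable_gaussM).aestronglyMeasurable (ae_of_all _ fun u => ?_)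
    rw [Real.norm_of_nonneg (mul_nonneg (hh0 v u) (gaussM_nonneg u))]
    exact mul_le_mul_of_nonneg_right (hhk v u) (gaussM_nonneg u)
  have hri := integrable_norm_pow_mul_relError hp k hv
  have hfi := ((hK v).1.const_mul (c * (Real.exp (-‖v‖ ^ 2 / 16) / jap v ^ p)))
  rw [← integral_div, ← integral_sub (hHi.div_const _) hhi]
  calc _ ≤ ∫ u : V3, (‖u‖ ^ k * relError p v u * gaussM u +
        c * (Real.exp (-‖v‖ ^ 2 / 16) / jap v ^ p) *
          (‖v - u‖ ^ q * Real.exp (-(1 / 4) * ‖u‖ ^ 2))) := by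
        refine norm_integral_le_of_norm_le (hri.add hfi) (ae_of_all _ fun u => ?_)
        have hg := gaussM_nonneg u
        by_cases hu : ‖u‖ ≤ ‖v‖ / 2
        · have hvu : v - u ≠ 0 := by
            intro h0
            rw [sub_eq_zero.1 h0] at hu hv
            linarith
          have hne : H v u * gaussM u / jap v ^ p - h v u * gaussM u =
              h v u * ((‖v - u‖ / jap v) ^ p - 1) * gaussM u := by
            rw [hHh v u hv0 hvu, Real.div_rpow (norm_nonneg _) hj.le]
            ring
          rw [hne, norm_mul, norm_mul, Real.norm_of_nonneg hg, Real.norm_of_nonneg (hh0 v u),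
            Real.norm_eq_abs, relError, if_pos hu]
          refine le_add_of_le_of_nonneg ?_ (by positivity)
          gcongr
          exact hhk v u
        · have hb := gaussM_le_of_half_norm_le (not_le.1 hu).le
          rw [relError, if_neg hu, zero_sub, abs_neg, abs_one, mul_one]
          have h1 : ‖H v u * gaussM u / jap v ^ p‖ ≤
              c * (Real.exp (-‖v‖ ^ 2 / 16) / jap v ^ p) *
              (‖v - u‖ ^ q * Real.exp (-(1 / 4) * ‖u‖ ^ 2)) := by
            have := hH0 v u
            rw [Real.norm_of_nonneg (by positivity)]
            calc _ ≤ ‖v - u‖ ^ q * (c * Real.exp (-‖v‖ ^ 2 / 16) *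
                  Real.exp (-(1 / 4) * ‖u‖ ^ 2)) / jap v ^ p := by
                  gcongr
                  exact hHq v u
              _ = _ := by ring
          have h2 : ‖h v u * gaussM u‖ ≤ ‖u‖ ^ k * gaussM u := by
            rw [Real.norm_of_nonneg (mul_nonneg (hh0 v u) hg)]
            exact mul_le_mul_of_nonneg_right (hhk v u) hg
          exact (norm_sub_le _ _).trans (by linarith)
    _ ≤ _ := by
        rw [integral_add hri hfi, integral_const_mul]
        gcongr
        exact (hK v).2

lemma sum_mul_eq_inner (x y : V3) : ∑ i, x i * y i = ⟪x, y⟫ := by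
  simp [PiLp.inner_apply, mul_comm]

/-- Squared sine of the angle between two vectors. -/
def sinSq (v w : V3) : ℝ := 1 - (⟪v, w⟫ / (‖v‖ * ‖w‖)) ^ 2

lemma measurable_sinSq (v : V3) : Measurable (sinSq v) := by
  unfold sinSq
  fun_prop

lemma sinSq_le_one (v w : V3) : sinSq v w ≤ 1 := by
  unfold sinSq
  linarith [sq_nonneg (⟪v, w⟫ / (‖v‖ * ‖w‖))]

lemma sinSq_nonneg (v w : V3) : 0 ≤ sinSq v w := by
  have h := (sq_le_one_iff_abs_le_one _).2 (abs_real_inner_div_norm_mul_norm_le_one v w)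
  unfold sinSq
  linarith

lemma sinSq_pos {v w : V3} (hw : w ∉ ℝ ∙ v) : 0 < sinSq v w := by
  refine (sinSq_nonneg v w).lt_of_ne' fun h => hw ?_
  have h1 : |⟪v, w⟫ / (‖v‖ * ‖w‖)| = 1 := by
    rw [← sq_eq_sq₀ (abs_nonneg _) zero_le_one, sq_abs]
    unfold sinSq at h
    linarith
  obtain ⟨-, r, -, hr⟩ := (abs_real_inner_div_norm_mul_norm_eq_one_iff v w).1 h1
  exact Submodule.mem_span_singleton.2 ⟨r, hr.symm⟩

/-- The squared length of the component of `v - u` orthogonal to `v` is that of `u`. -/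
lemma sinSq_sub_mul_norm_sq {v u : V3} (hv : v ≠ 0) (hw : v - u ≠ 0) :
    sinSq v (v - u) * ‖v - u‖ ^ 2 = ‖u‖ ^ 2 - (⟪v, u⟫ / ‖v‖) ^ 2 := by
  have hv' := norm_ne_zero_iff.2 hv
  have hw' := norm_ne_zero_iff.2 hw
  have h1 : sinSq v (v - u) * ‖v - u‖ ^ 2 = ‖v - u‖ ^ 2 - ⟪v, v - u⟫ ^ 2 / ‖v‖ ^ 2 := by
    unfold sinSq
    field_simp
  rw [h1, norm_sub_sq_real, inner_sub_right, real_inner_self_eq_norm_sq]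
  field_simp
  ring

lemma crossSq_eq (a b : V3) : crossSq a b = ‖a‖ ^ 2 * ‖b‖ ^ 2 - ⟪a, b⟫ ^ 2 := by
  rw [← sum_mul_eq_inner, EuclideanSpace.real_norm_sq_eq, EuclideanSpace.real_norm_sq_eq]
  simp only [crossSq, cross_apply, Fin.sum_univ_three, Matrix.cons_val]
  ring

lemma crossSq_normalized {v w : V3} (hv : v ≠ 0) (hw : w ≠ 0) :
    crossSq (‖v‖⁻¹ • v) (‖w‖⁻¹ • w) = sinSq v w := by
  have hv' := norm_ne_zero_iff.2 hv
  have hw' := norm_ne_zero_iff.2 hw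
  rw [crossSq_eq, norm_smul, norm_smul, norm_inv, norm_inv, norm_norm, norm_norm,
    real_inner_smul_left, real_inner_smul_right, sinSq]
  field_simp

lemma ell1_eq (γ : ℝ) (v : V3) :
    ell1 γ v = ∫ w : V3, sinSq v w * ‖w‖ ^ (γ + 2) * gaussM (v - w) := by
  simp only [ell1, sum_mul_eq_inner, sinSq]

lemma ell1_eq_shift (γ : ℝ) (v : V3) :
    ell1 γ v = ∫ u : V3, sinSq v (v - u) * ‖v - u‖ ^ (γ + 2) * gaussM u := by
  rw [ell1_eq, ← integral_sub_left_eq_self _ volume v]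
  simp only [sub_sub_cancel]

lemma Jfun_eq (q : ℝ) (v : V3) : Jfun q v = ∫ w : V3, ‖w‖ ^ q * gaussM (v - w) := by
  rw [Jfun, ← integral_sub_left_eq_self (fun w : V3 => ‖w‖ ^ q * gaussM (v - w)) volume v]
  simp only [sub_sub_cancel]

lemma integrable_norm_rpow_mul_gaussM_sub {q : ℝ} (hq : -3 < q) (hq0 : q ≤ 0) (v : V3) :
    Integrable (fun w : V3 => ‖w‖ ^ q * gaussM (v - w)) := by
  simpa only [sub_sub_cancel] using
    (integrable_norm_sub_rpow_mul_gaussM hq hq0 v).comp_sub_left v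

lemma integrable_sinSq_mul {q : ℝ} (hq : -3 < q) (hq0 : q ≤ 0) (v : V3) :
    Integrable (fun w : V3 => sinSq v w * ‖w‖ ^ q * gaussM (v - w)) := by
  refine (integrable_norm_rpow_mul_gaussM_sub hq hq0 v).mono' (Measurable.aestronglyMeasurable
    (((measurable_sinSq v).mul (by fun_prop)).mul (measurable_gaussM.comp (by fun_prop))))
    (ae_of_all _ fun w => ?_)
  have h0 := sinSq_nonneg v w
  have h1 := sinSq_le_one v w
  have hg := gaussM_nonneg (v - w)
  rw [Real.norm_of_nonneg (by positivity), mul_assoc]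
  exact mul_le_of_le_one_left (by positivity) h1

lemma ell1_pos {γ : ℝ} (hq : -3 < γ + 2) (hq0 : γ + 2 ≤ 0) {v : V3} (hv : v ≠ 0) :
    0 < ell1 γ v := by
  rw [ell1_eq]
  have hnn : ∀ w : V3, 0 ≤ sinSq v w * ‖w‖ ^ (γ + 2) * gaussM (v - w) := fun w =>
    mul_nonneg (mul_nonneg (sinSq_nonneg v w) (by positivity)) (gaussM_nonneg _)
  refine (integral_nonneg hnn).lt_of_ne' fun h => ?_
  rw [integral_eq_zero_iff_of_nonneg hnn (integrable_sinSq_mul hq hq0 v)] at h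
  have hspan : volume ((ℝ ∙ v : Submodule ℝ V3) : Set V3) = 0 := by
    refine Measure.addHaar_submodule _ _ fun htop => ?_
    have h1 := finrank_span_singleton (K := ℝ) hv
    rw [htop, finrank_top] at h1
    simp at h1
  have hns : ∀ᵐ w : V3, w ∉ (ℝ ∙ v : Submodule ℝ V3) := measure_eq_zero_iff_ae_notMem.1 hspan
  have hf : ∀ᵐ _ : V3, False := by
    filter_upwards [h, hns] with w hw hw'
    have hw0 : w ≠ 0 := by
      rintro rfl
      exact hw' (Submodule.zero_mem _)
    have : 0 < sinSq v w * ‖w‖ ^ (γ + 2) * gaussM (v - w) := by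
      have h1 := sinSq_pos hw'
      have h2 := norm_pos_iff.2 hw0
      unfold gaussM
      positivity
    exact this.ne' hw
  exact NeZero.ne (volume : Measure V3) (by simpa using hf)

lemma ell2_eq {γ : ℝ} (hq : -3 < γ + 2) (hq0 : γ + 2 < 0) {v : V3} (hv : v ≠ 0) :
    ell2 γ v = Jfun (γ + 2) v - 1 / 2 * ell1 γ v := by
  rw [ell1_eq, Jfun_eq, ← integral_const_mul, ← integral_sub
    (integrable_norm_rpow_mul_gaussM_sub hq hq0.le v)
    ((integrable_sinSq_mul hq hq0.le v).const_mul _), ell2]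
  congr 1
  ext w
  by_cases hw : w = 0
  · simp [hw, Real.zero_rpow hq0.ne]
  · rw [crossSq_normalized hv hw]
    ring

/-- The weight `‖w‖ ^ γ μ(v - w)`, written so that it is visibly dominated after multiplication
with a quadratic form in `w`. -/
def radialWeight (γ : ℝ) (v w : V3) : ℝ := ‖w‖ ^ (γ + 2) * gaussM (v - w) / ‖w‖ ^ 2

lemma radialWeight_nonneg (γ : ℝ) (v w : V3) : 0 ≤ radialWeight γ v w :=
  div_nonneg (mul_nonneg (by positivity) (gaussM_nonneg _)) (by positivity)

lemma norm_sq_mul_radialWeight {γ : ℝ} (hq0 : γ + 2 ≠ 0) (v w : V3) :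
    ‖w‖ ^ 2 * radialWeight γ v w = ‖w‖ ^ (γ + 2) * gaussM (v - w) := by
  by_cases hw : w = 0
  · simp [hw, radialWeight, Real.zero_rpow hq0]
  · have := norm_ne_zero_iff.2 hw
    unfold radialWeight
    field_simp

lemma radialWeight_map {γ : ℝ} {v : V3} (R : V3 ≃ₗᵢ[ℝ] V3) (hR : R v = v) (w : V3) :
    radialWeight γ v (R w) = radialWeight γ v w := by
  have h : ‖v - R w‖ = ‖v - w‖ := by
    rw [← R.norm_map (v - w), map_sub, hR]
  simp only [radialWeight, gaussM, R.norm_map, h]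

lemma integrable_inner_mul_inner_mul_radialWeight {γ : ℝ} (hq : -3 < γ + 2) (hq0 : γ + 2 < 0)
    (v x y : V3) : Integrable (fun w : V3 => ⟪x, w⟫ * ⟪y, w⟫ * radialWeight γ v w) := by
  have hm : Measurable (radialWeight γ v) := by
    unfold radialWeight gaussM
    fun_prop
  refine ((integrable_norm_rpow_mul_gaussM_sub hq hq0.le v).const_mul (‖x‖ * ‖y‖)).mono'
    (Measurable.aestronglyMeasurable (Measurable.mul (by fun_prop) hm)) (ae_of_all _ fun w => ?_)
  have h0 := radialWeight_nonneg γ v w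
  rw [← norm_sq_mul_radialWeight hq0.ne, norm_mul, norm_mul, Real.norm_of_nonneg h0]
  calc _ ≤ (‖x‖ * ‖w‖) * (‖y‖ * ‖w‖) * radialWeight γ v w := by
        gcongr <;> exact norm_inner_le_norm _ _
    _ = _ := by ring

lemma ell1_eq_Jfun_sub {γ : ℝ} (hq : -3 < γ + 2) (hq0 : γ + 2 < 0) {v : V3} (hv : v ≠ 0) :
    ell1 γ v = Jfun (γ + 2) v -
      (∫ w : V3, ⟪v, w⟫ * ⟪v, w⟫ * radialWeight γ v w) / ‖v‖ ^ 2 := by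
  rw [ell1_eq, Jfun_eq, ← integral_div, ← integral_sub
    (integrable_norm_rpow_mul_gaussM_sub hq hq0.le v)
    ((integrable_inner_mul_inner_mul_radialWeight hq hq0 v v v).div_const _)]
  congr 1
  ext w
  unfold sinSq radialWeight
  field_simp

/-- The matrix `ā(v)` in terms of second moments of the weight. -/
lemma sum_abar_mul {γ : ℝ} (hq : -3 < γ + 2) (hq0 : γ + 2 < 0) (v x : V3) (i : Fin 3) :
    ∑ j, abar γ v i j * x j = Jfun (γ + 2) v * x i -
      ∫ w : V3, ⟪EuclideanSpace.single i (1 : ℝ), w⟫ * ⟪x, w⟫ * radialWeight γ v w := by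
  have hF := integrable_norm_rpow_mul_gaussM_sub hq hq0.le v
  have hM := integrable_inner_mul_inner_mul_radialWeight hq hq0 v (EuclideanSpace.single i 1)
  have habar : ∀ j, abar γ v i j = (if i = j then (1 : ℝ) else 0) * Jfun (γ + 2) v -
      ∫ w : V3, ⟪EuclideanSpace.single i (1 : ℝ), w⟫ * ⟪EuclideanSpace.single j (1 : ℝ), w⟫ *
        radialWeight γ v w := by
    intro j
    rw [Jfun_eq, ← integral_const_mul, ← integral_sub (hF.const_mul _) (hM _), abar,
      ← integral_sub_left_eq_self _ volume v]
    congr 1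
    ext w
    simp only [sub_sub_cancel, aker, radialWeight, EuclideanSpace.inner_single_left, map_one,
      one_mul]
    ring
  have hx : ∫ w : V3, ⟪EuclideanSpace.single i (1 : ℝ), w⟫ * ⟪x, w⟫ * radialWeight γ v w =
      ∑ j, (∫ w : V3, ⟪EuclideanSpace.single i (1 : ℝ), w⟫ *
        ⟪EuclideanSpace.single j (1 : ℝ), w⟫ * radialWeight γ v w) * x j := by
    simp only [← integral_mul_const]
    rw [← integral_finsetSum _ fun j _ => (hM _).mul_const _]
    congr 1
    ext w
    rw [← sum_mul_eq_inner x w, Finset.mul_sum, Finset.sum_mul]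
    refine Finset.sum_congr rfl fun j _ => ?_
    simp only [EuclideanSpace.inner_single_left, map_one, one_mul]
    ring
  simp_rw [habar, sub_mul]
  rw [Finset.sum_sub_distrib, hx]
  simp

/-- The part of a standard Gaussian vector orthogonal to a given direction has variance two. -/
lemma integral_orthogonal_norm_sq_mul_gaussM {v : V3} (hv : v ≠ 0) :
    ∫ u : V3, (‖u‖ ^ 2 - (⟪v, u⟫ / ‖v‖) ^ 2) * gaussM u = 2 := by
  obtain ⟨b, hb⟩ := exists_orthonormalBasis_zero_eq hv
  have hint : ∀ i, Integrable fun u : V3 => ⟪b i, u⟫ ^ 2 * gaussM u := fun i =>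
    Integrable.of_integral_ne_zero (by rw [integral_inner_sq_mul_gaussM]; exact one_ne_zero)
  have hpt : ∀ u : V3, (‖u‖ ^ 2 - (⟪v, u⟫ / ‖v‖) ^ 2) * gaussM u =
      ⟪b 1, u⟫ ^ 2 * gaussM u + ⟪b 2, u⟫ ^ 2 * gaussM u := by
    intro u
    have h0 : ⟪v, u⟫ / ‖v‖ = ⟪b 0, u⟫ := by
      rw [hb, real_inner_smul_left]
      ring
    rw [h0, ← b.sum_sq_inner_right u, Fin.sum_univ_three]
    ring
  simp_rw [hpt]
  rw [integral_add (hint 1) (hint 2), integral_inner_sq_mul_gaussM, integral_inner_sq_mul_gaussM]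
  norm_num

lemma eventually_ne_zero_normAtTop : ∀ᶠ v : V3 in normAtTop, v ≠ 0 := by
  filter_upwards [tendsto_norm_normAtTop.eventually_gt_atTop 0] with v hv
  exact norm_pos_iff.1 hv

lemma tendsto_ell1_div {γ : ℝ} (hq : -3 < γ + 2) (hq0 : γ + 2 < 0) :
    Tendsto (fun v : V3 => ell1 γ v / jap v ^ γ) normAtTop (nhds 2) := by
  have h := tendsto_integral_div_jap_rpow_sub hq hq0.le (p := γ) (by linarith) 2
    (H := fun v u => sinSq v (v - u) * ‖v - u‖ ^ (γ + 2))
    (h := fun v u => ‖u‖ ^ 2 - (⟪v, u⟫ / ‖v‖) ^ 2)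
    (fun v => ((measurable_sinSq v).comp (by fun_prop)).mul (by fun_prop))
    (fun v => by fun_prop)
    (fun v u => mul_nonneg (sinSq_nonneg _ _) (by positivity))
    (fun v u => mul_le_of_le_one_left (by positivity) (sinSq_le_one _ _))
    (fun v u => ?_) (fun v u => by linarith [sq_nonneg (⟪v, u⟫ / ‖v‖)]) (fun v u hv hw => ?_)
  · have h2 := h.add_const 2
    rw [zero_add] at h2
    refine h2.congr' ?_
    filter_upwards [eventually_ne_zero_normAtTop] with v hv
    rw [integral_orthogonal_norm_sq_mul_gaussM hv, ell1_eq_shift]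
    ring
  · rw [sub_nonneg, sq_le_sq, abs_norm, abs_div, abs_norm]
    exact div_le_of_le_mul₀ (norm_nonneg _) (norm_nonneg _)
      ((abs_real_inner_le_norm v u).trans_eq (mul_comm _ _))
  · rw [← sinSq_sub_mul_norm_sq hv hw, Real.rpow_add (norm_pos_iff.2 hw), Real.rpow_two]
    ring

lemma tendsto_Jfun_div {q : ℝ} (hq : -3 < q) (hq0 : q ≤ 0) :
    Tendsto (fun v : V3 => Jfun q v / jap v ^ q) normAtTop (nhds 1) := by
  have h := tendsto_integral_div_jap_rpow_sub hq hq0 hq0 0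
    (H := fun v u => ‖v - u‖ ^ q) (h := fun _ _ => 1)
    (fun v => by fun_prop) (fun v => by fun_prop) (fun v u => by positivity) (fun v u => le_rfl)
    (fun _ _ => zero_le_one) (fun _ _ => by simp) (fun _ _ _ _ => (one_mul _).symm)
  have h2 := h.add_const 1
  simpa only [Jfun, one_mul, integral_gaussM, sub_add_cancel, zero_add] using h2

lemma tendsto_ell2_div {γ : ℝ} (hq : -3 < γ + 2) (hq0 : γ + 2 < 0) :
    Tendsto (fun v : V3 => ell2 γ v / jap v ^ (γ + 2)) normAtTop (nhds 1) := by
  have hsq : Tendsto (fun v : V3 => (jap v ^ 2)⁻¹) normAtTop (nhds 0) :=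
    ((tendsto_pow_atTop two_ne_zero).comp tendsto_jap_normAtTop).inv_tendsto_atTop
  have h := (tendsto_Jfun_div hq hq0.le).sub
    (((tendsto_ell1_div hq hq0).mul hsq).const_mul (1 / 2))
  simp only [mul_zero, sub_zero] at h
  refine h.congr' ?_
  filter_upwards [eventually_ne_zero_normAtTop] with v hv
  have hj := jap_pos v
  have hjr : 0 < jap v ^ γ := Real.rpow_pos_of_pos hj _
  rw [ell2_eq hq hq0 hv, Real.rpow_add hj, Real.rpow_two]
  field_simp

/-- Lemma 2.1 (a): ā(v) has simple eigenvalue ℓ₁(v) > 0 with eigenvector v, double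
eigenvalue ℓ₂(v) > 0 on v^⊥, and ℓ₁(v) ∼ 2⟨v⟩^γ, ℓ₂(v) ∼ ⟨v⟩^{γ+2} as |v| → ∞. -/
theorem stmt0 (γ : ℝ) (hγ : γ ∈ Set.Ico (-3 : ℝ) (-2)) :
    (∀ v : V3, v ≠ 0 →
      ((∀ i, (∑ j, abar γ v i j * v j) = ell1 γ v * v i) ∧
       (∀ ξ : V3, (∑ i, ξ i * v i) = 0 → ∀ i, (∑ j, abar γ v i j * ξ j) = ell2 γ v * ξ i) ∧
       0 < ell1 γ v ∧ 0 < ell2 γ v)) ∧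
    Filter.Tendsto (fun v : V3 => ell1 γ v / (2 * jap v ^ γ)) normAtTop (nhds 1) ∧
    Filter.Tendsto (fun v : V3 => ell2 γ v / jap v ^ (γ + 2)) normAtTop (nhds 1) := by
  have hq : -3 < γ + 2 := by linarith [hγ.1]
  have hq0 : γ + 2 < 0 := by linarith [hγ.2]
  refine ⟨fun v hv => ?_, ?_, tendsto_ell2_div hq hq0⟩
  · obtain ⟨hpar, hperp⟩ := secondMoment_of_invariant hv (K := radialWeight γ v)
      (fun R hR w => radialWeight_map R hR w)
      (integrable_inner_mul_inner_mul_radialWeight hq hq0 v)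
    have htrace : ∫ w : V3, ‖w‖ ^ 2 * radialWeight γ v w = Jfun (γ + 2) v := by
      simp_rw [norm_sq_mul_radialWeight hq0.ne, Jfun_eq]
    have hell1 := ell1_eq_Jfun_sub hq hq0 hv
    have hell2 := ell2_eq hq hq0 hv
    have hpos := ell1_pos hq hq0.le hv
    have hsec : 0 ≤ (∫ w : V3, ⟪v, w⟫ * ⟪v, w⟫ * radialWeight γ v w) / ‖v‖ ^ 2 :=
      div_nonneg (integral_nonneg fun w =>
        mul_nonneg (mul_self_nonneg _) (radialWeight_nonneg γ v w)) (by positivity)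
    refine ⟨fun i => ?_, fun ξ hξ i => ?_, hpos, by linarith⟩
    · rw [sum_abar_mul hq hq0, hpar, hell1, EuclideanSpace.inner_single_left]
      simp only [map_one, one_mul]
      ring
    · rw [sum_mul_eq_inner] at hξ
      rw [sum_abar_mul hq hq0, hperp ξ hξ, hell2, hell1, htrace,
        EuclideanSpace.inner_single_left]
      simp only [map_one, one_mul]
      ring
  · have h := (tendsto_ell1_div hq hq0).div_const 2
    rw [div_self two_ne_zero] at h
    refine h.congr fun v => ?_
    rw [div_div, mul_comm]
end
end

section
/- Let γ ∈ [−3,−2). For every v ∈ ℝ³ with v ≠ 0 and every ξ ∈ ℝ³ one has the identity Σ_{i,j} ā_{ij}(v) ξ_i ξ_j = ℓ₁(v)|P_v ξ|² + ℓ₂(v)|(I − P_v)ξ|². Moreover there exists a constant K > 0 such that for all v ≠ 0 and all ξ ∈ ℝ³, Σ_{i,j} ā_{ij}(v) ξ_i ξ_j ≥ K ( ⟨v⟩^γ |P_v ξ|² + ⟨v⟩^{γ+2} |(I − P_v)ξ|² ). -/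
noncomputable section

open MeasureTheory Real Filter

lemma gaussM_pos (v : V3) : 0 < gaussM v := by
  unfold gaussM; positivity

lemma continuous_gaussM : Continuous gaussM := by
  unfold gaussM; fun_prop

lemma gaussM_le (v : V3) : gaussM v ≤ (2 * π) ^ (-(3 : ℝ) / 2) := by
  unfold gaussM
  refine mul_le_of_le_one_right (by positivity) (Real.exp_le_one_iff.2 ?_)
  have := sq_nonneg ‖v‖
  linarith

lemma le_gaussM {u : V3} (hu : ‖u‖ ≤ 2) :
    (2 * π) ^ (-(3 : ℝ) / 2) * Real.exp (-2) ≤ gaussM u := by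
  unfold gaussM
  gcongr
  have := norm_nonneg u
  nlinarith

lemma gaussM_map (R : V3 ≃ₗᵢ[ℝ] V3) (v : V3) : gaussM (R v) = gaussM v := by
  simp [gaussM]

lemma integrable_gaussM : Integrable gaussM := by
  have h := (GaussianFourier.integrable_cexp_neg_mul_sq_norm_add (V := V3)
    (b := (1 / 2 : ℂ)) (by norm_num) 0 0).norm
  refine (h.const_mul ((2 * π) ^ (-(3 : ℝ) / 2))).congr (ae_of_all _ fun v => ?_)
  have hexp : (-(1 / 2 : ℂ) * (‖v‖ : ℂ) ^ 2 + 0 * ((inner ℝ (0 : V3) v : ℝ) : ℂ))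
      = ((-‖v‖ ^ 2 / 2 : ℝ) : ℂ) := by
    push_cast
    ring
  simp only [gaussM, Complex.norm_exp, hexp, Complex.ofReal_re]

/-- The density `‖w‖ ^ β * μ(v - w)`, against which all the integrals are taken. -/
def powGauss (β : ℝ) (v w : V3) : ℝ := ‖w‖ ^ β * gaussM (v - w)

lemma powGauss_nonneg (β : ℝ) (v w : V3) : 0 ≤ powGauss β v w :=
  mul_nonneg (by positivity) (gaussM_pos _).le

lemma integrable_powGauss {β : ℝ} (h₁ : -3 < β) (h₂ : β ≤ 0) (v : V3) :
    Integrable (powGauss β v) := by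
  have hsing : Integrable (fun w : V3 => (Set.Iic (1 : ℝ)).indicator (fun r => r ^ β) ‖w‖) := by
    rw [integrable_fun_norm_addHaar (volume : Measure V3)
      (f := (Set.Iic (1 : ℝ)).indicator (fun r => r ^ β))]
    have hIoc : IntegrableOn (fun r : ℝ => r ^ (2 + β)) (Set.Ioc 0 1) := by
      rw [integrableOn_Ioc_iff_integrableOn_Ioo]
      exact (intervalIntegral.integrableOn_Ioo_rpow_iff one_pos).2 (by linarith)
    have hind := (integrable_indicator_iff measurableSet_Ioc).2 hIoc
    refine hind.integrableOn.congr_fun (s := Set.Ioi 0) (fun r hr => ?_) measurableSet_Ioi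
    have hr : 0 < r := hr
    by_cases h : r ≤ 1
    · simp [Set.indicator, h, hr, Real.rpow_add hr]
    · simp [Set.indicator, h]
  refine ((hsing.mul_const ((2 * π) ^ (-(3 : ℝ) / 2))).add
    (integrable_gaussM.comp_sub_left v)).mono' ?_ (ae_of_all _ fun w => ?_)
  · have := continuous_gaussM.measurable
    unfold powGauss
    exact Measurable.aestronglyMeasurable (by fun_prop)
  · rw [Real.norm_of_nonneg (powGauss_nonneg _ _ _)]
    have hg := (gaussM_pos (v - w)).le
    have hc : (0 : ℝ) ≤ (2 * π) ^ (-(3 : ℝ) / 2) := by positivity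
    simp only [powGauss, Pi.add_apply]
    by_cases h : ‖w‖ ≤ 1
    · have := mul_le_mul_of_nonneg_left (gaussM_le (v - w)) (show 0 ≤ ‖w‖ ^ β by positivity)
      simp only [Set.indicator, Set.mem_Iic, h, if_true]
      linarith
    · have := mul_le_mul_of_nonneg_right
        (Real.rpow_le_one_of_one_le_of_nonpos (not_le.1 h).le h₂) hg
      simp only [Set.indicator, Set.mem_Iic, h, if_false]
      linarith

open scoped RealInnerProductSpace

/-- The weighted second moment form of `w / ‖w‖`. -/
def momentForm (β : ℝ) (v x y : V3) : ℝ :=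
  ∫ w : V3, ⟪w, x⟫ * ⟪w, y⟫ / ‖w‖ ^ 2 * powGauss β v w

lemma abs_inner_mul_inner_div_le (x y w : V3) : |⟪w, x⟫ * ⟪w, y⟫ / ‖w‖ ^ 2| ≤ ‖x‖ * ‖y‖ := by
  rw [abs_div, abs_mul, abs_of_nonneg (sq_nonneg ‖w‖)]
  refine div_le_of_le_mul₀ (by positivity) (by positivity) ?_
  calc |⟪w, x⟫| * |⟪w, y⟫| ≤ (‖w‖ * ‖x‖) * (‖w‖ * ‖y‖) := by
        gcongr <;> exact abs_real_inner_le_norm _ _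
    _ = ‖x‖ * ‖y‖ * ‖w‖ ^ 2 := by ring

lemma integrable_moment {β : ℝ} (h₁ : -3 < β) (h₂ : β ≤ 0) (v x y : V3) :
    Integrable (fun w : V3 => ⟪w, x⟫ * ⟪w, y⟫ / ‖w‖ ^ 2 * powGauss β v w) :=
  (integrable_powGauss h₁ h₂ v).bdd_mul (Measurable.aestronglyMeasurable (by fun_prop))
    (ae_of_all _ fun w => abs_inner_mul_inner_div_le x y w)

lemma momentForm_add_self {β : ℝ} (h₁ : -3 < β) (h₂ : β ≤ 0) (v x y : V3) :
    momentForm β v (x + y) (x + y)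
      = momentForm β v x x + 2 * momentForm β v x y + momentForm β v y y := by
  have hi := integrable_moment h₁ h₂ v
  unfold momentForm
  have hxy := (hi x y).const_mul 2
  have hadd := (hi x x).add hxy
  simp only [Pi.add_def] at hadd
  rw [← integral_const_mul, ← integral_add (hi x x) hxy, ← integral_add hadd (hi y y)]
  congr 1 with w
  simp only [inner_add_right]
  ring

lemma momentForm_smul_self (β : ℝ) (v x : V3) (c : ℝ) :
    momentForm β v (c • x) (c • x) = c ^ 2 * momentForm β v x x := by
  unfold momentForm
  rw [← integral_const_mul]
  congr 1 with w
  simp only [inner_smul_right]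
  ring

lemma momentForm_map {v : V3} (β : ℝ) (R : V3 ≃ₗᵢ[ℝ] V3) (hv : R v = v) (x y : V3) :
    momentForm β v (R x) (R y) = momentForm β v x y := by
  unfold momentForm
  rw [← R.measurePreserving.integral_comp R.toHomeomorph.measurableEmbedding]
  congr 1 with w
  have : gaussM (v - R w) = gaussM (v - w) := by
    rw [← gaussM_map R (v - w), map_sub, hv]
  simp [powGauss, this]

lemma reflection_orthogonal_apply_of_inner_eq_zero {v x : V3} (h : ⟪x, v⟫ = 0) :
    (ℝ ∙ x)ᗮ.reflection v = v :=
  Submodule.reflection_mem_subspace_eq_self (Submodule.mem_orthogonal_singleton_iff_inner_right.2 h)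

lemma momentForm_eq_zero {v x y : V3} (β : ℝ) (hx : ⟪y, x⟫ = 0) (hv : ⟪y, v⟫ = 0) :
    momentForm β v x y = 0 := by
  have h := momentForm_map β _ (reflection_orthogonal_apply_of_inner_eq_zero hv) x y
  rw [reflection_orthogonal_apply_of_inner_eq_zero hx,
    Submodule.reflection_orthogonalComplement_singleton_eq_neg] at h
  have h' : momentForm β v x (-y) = - momentForm β v x y := by
    simp [momentForm, neg_div, integral_neg]
  linarith

lemma momentForm_self_eq {v x y : V3} (β : ℝ) (hxy : ‖x‖ = ‖y‖) (hx : ⟪x, v⟫ = 0)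
    (hy : ⟪y, v⟫ = 0) : momentForm β v x x = momentForm β v y y := by
  have h := momentForm_map β (ℝ ∙ (x - y))ᗮ.reflection
    (reflection_orthogonal_apply_of_inner_eq_zero (v := v) (by simp [inner_sub_left, hx, hy])) x x
  rw [Submodule.reflection_sub hxy] at h
  exact h.symm

lemma inner_eq_sum (x y : V3) : ⟪x, y⟫ = x 0 * y 0 + x 1 * y 1 + x 2 * y 2 := by
  simp [PiLp.inner_apply, Fin.sum_univ_three, mul_comm]

lemma norm_sq_eq_sum (x : V3) : ‖x‖ ^ 2 = x 0 ^ 2 + x 1 ^ 2 + x 2 ^ 2 := by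
  rw [← real_inner_self_eq_norm_sq, inner_eq_sum]
  ring

lemma exists_orthogonal_frame {e x : V3} (he : ‖e‖ = 1) (hx : ⟪x, e⟫ = 0) :
    ∃ y : V3, ‖x‖ = ‖y‖ ∧ ⟪y, e⟫ = 0 ∧
      ∀ w : V3, ⟪w, x⟫ ^ 2 + ⟪w, y⟫ ^ 2 = ‖x‖ ^ 2 * (‖w‖ ^ 2 - ⟪w, e⟫ ^ 2) := by
  have he' : e 0 ^ 2 + e 1 ^ 2 + e 2 ^ 2 = 1 := by rw [← norm_sq_eq_sum, he]; norm_num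
  rw [inner_eq_sum] at hx
  refine ⟨!₂[e 1 * x 2 - e 2 * x 1, e 2 * x 0 - e 0 * x 2, e 0 * x 1 - e 1 * x 0], ?_, ?_, ?_⟩
  · rw [← sq_eq_sq₀ (norm_nonneg _) (norm_nonneg _), norm_sq_eq_sum, norm_sq_eq_sum]
    simp
    linear_combination (-(x 0 ^ 2 + x 1 ^ 2 + x 2 ^ 2)) * he'
      + (x 0 * e 0 + x 1 * e 1 + x 2 * e 2) * hx
  · rw [inner_eq_sum]
    simp
    ring
  · intro w
    simp only [inner_eq_sum, norm_sq_eq_sum]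
    simp
    generalize x 0 = x0 at *
    generalize x 1 = x1 at *
    generalize x 2 = x2 at *
    generalize e 0 = e0 at *
    generalize e 1 = e1 at *
    generalize e 2 = e2 at *
    linear_combination ((w 0 ^ 2 + w 1 ^ 2 + w 2 ^ 2) * (x0 ^ 2 + x1 ^ 2 + x2 ^ 2)
        - (w 0 * x0 + w 1 * x1 + w 2 * x2) ^ 2) * he'
      + (2 * (w 0 * x0 + w 1 * x1 + w 2 * x2) * (w 0 * e0 + w 1 * e1 + w 2 * e2)
        - (x0 * e0 + x1 * e1 + x2 * e2) * (w 0 ^ 2 + w 1 ^ 2 + w 2 ^ 2)) * hx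


lemma momentForm_self_of_orthogonal {β : ℝ} (h₁ : -3 < β) (h₂ : β ≤ 0) (hβ : β ≠ 0) {e x : V3}
    (r : ℝ) (he : ‖e‖ = 1) (hx : ⟪x, e⟫ = 0) :
    2 * momentForm β (r • e) x x
      = ‖x‖ ^ 2 * ((∫ w, powGauss β (r • e) w) - momentForm β (r • e) e e) := by
  obtain ⟨y, hxy, hy, hw⟩ := exists_orthogonal_frame he hx
  have hsame : momentForm β (r • e) x x = momentForm β (r • e) y y :=
    momentForm_self_eq β hxy (by simp [inner_smul_right, hx]) (by simp [inner_smul_right, hy])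
  have hi := integrable_moment h₁ h₂ (r • e)
  have hsum : momentForm β (r • e) x x + momentForm β (r • e) y y
      = ‖x‖ ^ 2 * ((∫ w, powGauss β (r • e) w) - momentForm β (r • e) e e) := by
    unfold momentForm
    rw [← integral_add (hi x x) (hi y y), ← integral_sub (integrable_powGauss h₁ h₂ _) (hi e e),
      ← integral_const_mul]
    congr 1 with w
    rcases eq_or_ne w 0 with rfl | h0
    · simp [powGauss, Real.zero_rpow hβ]
    · have := norm_ne_zero_iff.2 h0
      have hww := hw w
      field_simp
      linear_combination (powGauss β (r • e) w) * hww
  linarith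

lemma sum_abar_eq {γ : ℝ} (h₁ : -3 < γ + 2) (h₂ : γ + 2 ≤ 0) (v ξ : V3) :
    (∑ i, ∑ j, abar γ v i j * ξ i * ξ j)
      = ‖ξ‖ ^ 2 * (∫ w, powGauss (γ + 2) v w) - momentForm (γ + 2) v ξ ξ := by
  set b : Fin 3 → V3 := fun i => EuclideanSpace.single i 1 with hb
  have hi := integrable_moment h₁ h₂ v
  have hp := integrable_powGauss h₁ h₂ v
  have habar : ∀ i j, abar γ v i j
      = (if i = j then (1 : ℝ) else 0) * (∫ w, powGauss (γ + 2) v w)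
        - momentForm (γ + 2) v (b i) (b j) := by
    intro i j
    unfold abar momentForm
    rw [← integral_const_mul, ← integral_sub (hp.const_mul _) (hi _ _),
      ← integral_sub_left_eq_self _ _ v]
    congr 1 with w
    simp only [aker, powGauss, hb, sub_sub_cancel, EuclideanSpace.inner_single_right, one_mul,
      conj_trivial]
    ring
  have hform : momentForm (γ + 2) v ξ ξ
      = ∑ i, ∑ j, momentForm (γ + 2) v (b i) (b j) * ξ i * ξ j := by
    unfold momentForm
    simp only [← integral_mul_const]
    have hint : ∀ i j, Integrable (fun w : V3 =>
        ⟪w, b i⟫ * ⟪w, b j⟫ / ‖w‖ ^ 2 * powGauss (γ + 2) v w * ξ i * ξ j) :=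
      fun i j => ((hi _ _).mul_const _).mul_const _
    simp_rw [← integral_finsetSum _ fun j _ => hint _ j]
    rw [← integral_finsetSum _ fun i _ => integrable_finsetSum _ fun j _ => hint i j]
    congr 1 with w
    simp only [hb, EuclideanSpace.inner_single_right, Fin.sum_univ_three, inner_eq_sum w ξ]
    simp
    ring
  rw [hform]
  simp only [habar, Fin.sum_univ_three, norm_sq_eq_sum]
  simp
  ring

lemma norm_inv_norm_smul {v : V3} (hv : v ≠ 0) : ‖‖v‖⁻¹ • v‖ = 1 := by
  rw [norm_smul, norm_inv, norm_norm, inv_mul_cancel₀ (norm_ne_zero_iff.2 hv)]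

lemma ell1_integrand_eq {v : V3} (hv : v ≠ 0) (γ : ℝ) (w : V3) :
    (1 - ((∑ i, v i * w i) / (‖v‖ * ‖w‖)) ^ 2) * ‖w‖ ^ (γ + 2) * gaussM (v - w)
      = (1 - ⟪w, ‖v‖⁻¹ • v⟫ * ⟪w, ‖v‖⁻¹ • v⟫ / ‖w‖ ^ 2) * powGauss (γ + 2) v w := by
  have hsum : ∑ i, v i * w i = ⟪w, v⟫ := by simp [PiLp.inner_apply]
  have := norm_ne_zero_iff.2 hv
  rw [hsum, inner_smul_right, powGauss]
  field_simp

lemma ell2_integrand_eq {v : V3} (hv : v ≠ 0) {γ : ℝ} (hγ : γ + 2 ≠ 0) (w : V3) :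
    (1 - (1 / 2) * crossSq (‖v‖⁻¹ • v) (‖w‖⁻¹ • w)) * ‖w‖ ^ (γ + 2) * gaussM (v - w)
      = (1 / 2) * ((1 + ⟪w, ‖v‖⁻¹ • v⟫ * ⟪w, ‖v‖⁻¹ • v⟫ / ‖w‖ ^ 2) * powGauss (γ + 2) v w) := by
  rcases eq_or_ne w 0 with rfl | h0
  · simp [powGauss, Real.zero_rpow hγ]
  · have hv' := norm_ne_zero_iff.2 hv
    have hw' := norm_ne_zero_iff.2 h0
    rw [crossSq_eq, norm_inv_norm_smul hv, norm_inv_norm_smul h0, powGauss]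
    simp only [inner_smul_right, inner_smul_left, real_inner_comm w v]
    simp
    field_simp
    ring


lemma ell1_eq_s2 {γ : ℝ} (h₁ : -3 < γ + 2) (h₂ : γ + 2 ≤ 0) {v : V3} (hv : v ≠ 0) :
    ell1 γ v = (∫ w, powGauss (γ + 2) v w)
      - momentForm (γ + 2) v (‖v‖⁻¹ • v) (‖v‖⁻¹ • v) := by
  unfold ell1 momentForm
  rw [← integral_sub (integrable_powGauss h₁ h₂ v) (integrable_moment h₁ h₂ v _ _)]
  simp_rw [ell1_integrand_eq hv, sub_mul, one_mul]

lemma ell2_eq_s2 {γ : ℝ} (h₁ : -3 < γ + 2) (h₂ : γ + 2 < 0) {v : V3} (hv : v ≠ 0) :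
    ell2 γ v = (1 / 2) * ((∫ w, powGauss (γ + 2) v w)
      + momentForm (γ + 2) v (‖v‖⁻¹ • v) (‖v‖⁻¹ • v)) := by
  unfold ell2 momentForm
  rw [← integral_add (integrable_powGauss h₁ h₂.le v) (integrable_moment h₁ h₂.le v _ _),
    ← integral_const_mul]
  simp_rw [ell2_integrand_eq hv h₂.ne, add_mul, one_mul]

lemma Pv_eq {v : V3} (hv : v ≠ 0) (ξ : V3) :
    Pv v ξ = ⟪ξ, ‖v‖⁻¹ • v⟫ • (‖v‖⁻¹ • v) := by
  have hsum : ∑ i, ξ i * v i = ⟪ξ, v⟫ := by simp [PiLp.inner_apply, mul_comm]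
  have := norm_ne_zero_iff.2 hv
  rw [Pv, hsum, inner_smul_right, smul_smul]
  congr 1
  field_simp

lemma sum_abar_eq_ell {γ : ℝ} (h₁ : -3 < γ + 2) (h₂ : γ + 2 < 0) {v : V3} (hv : v ≠ 0) (ξ : V3) :
    (∑ i, ∑ j, abar γ v i j * ξ i * ξ j)
      = ell1 γ v * ‖Pv v ξ‖ ^ 2 + ell2 γ v * ‖ξ - Pv v ξ‖ ^ 2 := by
  rw [sum_abar_eq h₁ h₂.le, ell1_eq_s2 h₁ h₂.le hv, ell2_eq_s2 h₁ h₂ hv, Pv_eq hv]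
  have he := norm_inv_norm_smul hv
  have hve : ‖v‖ • (‖v‖⁻¹ • v) = v := smul_inv_smul₀ (norm_ne_zero_iff.2 hv) v
  generalize ‖v‖⁻¹ • v = e at he hve ⊢
  obtain ⟨η, hη⟩ : ∃ η, η = ξ - ⟪ξ, e⟫ • e := ⟨_, rfl⟩
  have hηe : ⟪η, e⟫ = 0 := by
    rw [hη, inner_sub_left, real_inner_smul_left, real_inner_self_eq_norm_sq, he]
    ring
  have hξ : ξ = ⟪ξ, e⟫ • e + η := by rw [hη]; abel
  have hM : momentForm (γ + 2) v ξ ξ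
      = ⟪ξ, e⟫ ^ 2 * momentForm (γ + 2) v e e + momentForm (γ + 2) v η η := by
    conv_lhs => rw [hξ]
    rw [momentForm_add_self h₁ h₂.le, momentForm_smul_self,
      momentForm_eq_zero (x := ⟪ξ, e⟫ • e) (y := η)]
    · ring
    · simp [inner_smul_right, hηe]
    · rw [← hve]
      simp [inner_smul_right, hηe]
  have hMη := momentForm_self_of_orthogonal h₁ h₂.le h₂.ne ‖v‖ he hηe
  rw [hve] at hMη
  have hnorm : ‖ξ‖ ^ 2 = ⟪ξ, e⟫ ^ 2 + ‖η‖ ^ 2 := by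
    rw [hη, norm_sub_sq_real, norm_smul, he, inner_smul_right, Real.norm_eq_abs, mul_one, sq_abs]
    ring
  have hp : ‖⟪ξ, e⟫ • e‖ ^ 2 = ⟪ξ, e⟫ ^ 2 := by
    rw [norm_smul, he, Real.norm_eq_abs, mul_one, sq_abs]
  rw [← hη, hp, hM, hnorm]
  linear_combination (-1 / 2) * hMη

lemma exists_unit_orthogonal (e : V3) : ∃ u : V3, ‖u‖ = 1 ∧ ⟪e, u⟫ = 0 := by
  have hne : (ℝ ∙ e)ᗮ ≠ ⊥ := by
    intro h
    have h₁ := Submodule.finrank_add_finrank_orthogonal (ℝ ∙ e)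
    have h₂ := finrank_span_le_card (R := ℝ) ({e} : Set V3)
    rw [h, finrank_bot, finrank_euclideanSpace_fin] at h₁
    simp at h₂
    omega
  obtain ⟨x, hx, hx0⟩ := Submodule.exists_mem_ne_zero_of_ne_bot hne
  refine ⟨‖x‖⁻¹ • x, norm_inv_norm_smul hx0, ?_⟩
  rw [inner_smul_right, Submodule.mem_orthogonal_singleton_iff_inner_right.1 hx, mul_zero]

lemma one_le_jap (v : V3) : 1 ≤ jap v :=
  Real.one_le_sqrt.2 (by have := sq_nonneg ‖v‖; linarith)

lemma quarter_le_of_mem_ball {v e u w : V3} (he : ‖e‖ = 1) (hu : ‖u‖ = 1) (heu : ⟪e, u⟫ = 0)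
    (hvu : ⟪v, u⟫ = 0) (hw : w ∈ Metric.ball (v + u) (1 / 2)) :
    1 / 4 ≤ ‖w‖ ^ 2 - ⟪w, e⟫ ^ 2 := by
  have hdist : ‖w - (v + u)‖ < 1 / 2 := by rwa [Metric.mem_ball, dist_eq_norm] at hw
  have hcs := (abs_le.1 (abs_real_inner_le_norm (w - (v + u)) u)).1
  rw [inner_sub_left, inner_add_left, hvu, real_inner_self_eq_norm_sq, hu] at hcs
  have hperp := real_inner_le_norm (w - ⟪w, e⟫ • e) u
  rw [inner_sub_left, real_inner_smul_left, heu, hu] at hperp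
  have hsq : ‖w - ⟪w, e⟫ • e‖ ^ 2 = ‖w‖ ^ 2 - ⟪w, e⟫ ^ 2 := by
    rw [norm_sub_sq_real, norm_smul, he, inner_smul_right, Real.norm_eq_abs, mul_one, sq_abs]
    ring
  rw [← hsq]
  nlinarith

lemma le_integral_of_le_on_ball {f : V3 → ℝ} (hf : Integrable f) (h0 : ∀ w, 0 ≤ f w) {x : V3}
    {r c : ℝ} (hc : ∀ w ∈ Metric.ball x r, c ≤ f w) :
    volume.real (Metric.ball (0 : V3) r) * c ≤ ∫ w, f w := by
  rw [← Measure.addHaar_real_ball_center volume x r]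
  exact (setIntegral_ge_of_const_le measurableSet_ball measure_ball_lt_top.ne hc
    hf.integrableOn).trans (setIntegral_le_integral hf (ae_of_all _ h0))

lemma norm_le_of_mem_ball {v u w : V3} (hu : ‖u‖ = 1) (hw : w ∈ Metric.ball (v + u) (1 / 2)) :
    ‖v - w‖ ≤ 2 ∧ ‖w‖ ≤ 3 * jap v := by
  have hdist : ‖w - (v + u)‖ < 1 / 2 := by rwa [Metric.mem_ball, dist_eq_norm] at hw
  have hvw : ‖v - w‖ ≤ 2 := by
    have h := norm_add_le (w - (v + u)) u
    rw [show w - (v + u) + u = -(v - w) by abel, norm_neg] at h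
    linarith
  refine ⟨hvw, ?_⟩
  have h := norm_sub_le v (v - w)
  rw [sub_sub_cancel] at h
  linarith [one_le_jap v, norm_le_jap v]

/-- The common constant in the lower bounds for `ell1` and `ell2`. -/
def lowerConst (γ : ℝ) : ℝ :=
  volume.real (Metric.ball (0 : V3) (1 / 2))
    * ((1 / 4) * 3 ^ γ * ((2 * π) ^ (-(3 : ℝ) / 2) * Real.exp (-2)))

lemma lowerConst_pos (γ : ℝ) : 0 < lowerConst γ := by
  have : 0 < volume.real (Metric.ball (0 : V3) (1 / 2)) :=
    ENNReal.toReal_pos (Metric.measure_ball_pos _ _ (by norm_num)).ne' measure_ball_lt_top.ne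
  unfold lowerConst
  positivity

lemma moment_le_one {e : V3} (he : ‖e‖ = 1) (w : V3) : ⟪w, e⟫ * ⟪w, e⟫ / ‖w‖ ^ 2 ≤ 1 := by
  simpa [he] using (abs_le.1 (abs_inner_mul_inner_div_le e e w)).2

lemma lowerConst_mul_le_ell1 {γ : ℝ} (h₁ : -3 < γ + 2) (h₂ : γ + 2 < 0) {v : V3} (hv : v ≠ 0) :
    lowerConst γ * jap v ^ γ ≤ ell1 γ v := by
  have he := norm_inv_norm_smul hv
  obtain ⟨u, hu, hvu⟩ := exists_unit_orthogonal v
  have heu : ⟪‖v‖⁻¹ • v, u⟫ = 0 := by rw [real_inner_smul_left, hvu, mul_zero]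
  have hj := one_le_jap v
  unfold ell1
  simp_rw [ell1_integrand_eq hv]
  generalize ‖v‖⁻¹ • v = e at he heu ⊢
  rw [lowerConst, mul_assoc]
  refine le_integral_of_le_on_ball (x := v + u) ?_ (fun w => ?_) fun w hw => ?_
  · simp_rw [sub_mul, one_mul]
    exact (integrable_powGauss h₁ h₂.le v).sub (integrable_moment h₁ h₂.le v _ _)
  · exact mul_nonneg (sub_nonneg.2 (moment_le_one he w)) (powGauss_nonneg _ _ _)
  · have hq := quarter_le_of_mem_ball he hu heu hvu hw
    obtain ⟨hvw, hwj⟩ := norm_le_of_mem_ball hu hw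
    have hw0 : 0 < ‖w‖ := by
      refine norm_pos_iff.2 ?_
      rintro rfl
      norm_num at hq
    have hpow := Real.rpow_le_rpow_of_nonpos hw0 hwj (show γ ≤ 0 by linarith)
    rw [Real.mul_rpow (by norm_num) (by linarith)] at hpow
    have heq : (1 - ⟪w, e⟫ * ⟪w, e⟫ / ‖w‖ ^ 2) * powGauss (γ + 2) v w
        = (‖w‖ ^ 2 - ⟪w, e⟫ ^ 2) * ‖w‖ ^ γ * gaussM (v - w) := by
      rw [powGauss, Real.rpow_add hw0, Real.rpow_two]
      field_simp
    rw [heq]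
    calc 1 / 4 * 3 ^ γ * ((2 * π) ^ (-(3 : ℝ) / 2) * Real.exp (-2)) * jap v ^ γ
        = 1 / 4 * (3 ^ γ * jap v ^ γ) * ((2 * π) ^ (-(3 : ℝ) / 2) * Real.exp (-2)) := by ring
      _ ≤ _ := by
        gcongr
        exact le_gaussM hvw

lemma lowerConst_mul_le_ell2 {γ : ℝ} (h₁ : -3 < γ + 2) (h₂ : γ + 2 < 0) {v : V3} (hv : v ≠ 0) :
    lowerConst γ * jap v ^ (γ + 2) ≤ ell2 γ v := by
  have he := norm_inv_norm_smul hv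
  obtain ⟨u, hu, hvu⟩ := exists_unit_orthogonal v
  have heu : ⟪‖v‖⁻¹ • v, u⟫ = 0 := by rw [real_inner_smul_left, hvu, mul_zero]
  have hj := one_le_jap v
  unfold ell2
  simp_rw [ell2_integrand_eq hv h₂.ne]
  generalize ‖v‖⁻¹ • v = e at he heu ⊢
  rw [lowerConst, mul_assoc]
  have hmom : ∀ w : V3, 0 ≤ ⟪w, e⟫ * ⟪w, e⟫ / ‖w‖ ^ 2 := fun w =>
    div_nonneg (mul_self_nonneg _) (sq_nonneg _)
  refine le_integral_of_le_on_ball (x := v + u) ?_ (fun w => ?_) fun w hw => ?_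
  · simp_rw [add_mul, one_mul]
    exact ((integrable_powGauss h₁ h₂.le v).add (integrable_moment h₁ h₂.le v _ _)).const_mul _
  · have := hmom w
    have := powGauss_nonneg (γ + 2) v w
    positivity
  · have hq := quarter_le_of_mem_ball he hu heu hvu hw
    obtain ⟨hvw, hwj⟩ := norm_le_of_mem_ball hu hw
    have hw0 : 0 < ‖w‖ := by
      refine norm_pos_iff.2 ?_
      rintro rfl
      norm_num at hq
    have hpow := Real.rpow_le_rpow_of_nonpos hw0 hwj h₂.le
    rw [Real.mul_rpow (by norm_num) (by linarith)] at hpow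
    have h3 : (3 : ℝ) ^ γ ≤ 3 ^ (γ + 2) :=
      Real.rpow_le_rpow_of_exponent_le (by norm_num) (by linarith)
    have hpg : 3 ^ γ * jap v ^ (γ + 2) * ((2 * π) ^ (-(3 : ℝ) / 2) * Real.exp (-2))
        ≤ powGauss (γ + 2) v w := by
      refine mul_le_mul (le_trans ?_ hpow) (le_gaussM hvw) (by positivity) (by positivity)
      gcongr
    have := mul_nonneg (hmom w) (powGauss_nonneg (γ + 2) v w)
    linarith [powGauss_nonneg (γ + 2) v w]

/-- Lemma 2.1 (b), second part: the quadratic form identity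
Σ ā_{ij}(v) ξ_i ξ_j = ℓ₁(v)|P_v ξ|² + ℓ₂(v)|(I−P_v)ξ|² and the coercivity lower bound. -/
theorem stmt2 (γ : ℝ) (hγ : γ ∈ Set.Ico (-3 : ℝ) (-2)) :
    (∀ v : V3, v ≠ 0 → ∀ ξ : V3,
      (∑ i, ∑ j, abar γ v i j * ξ i * ξ j)
        = ell1 γ v * ‖Pv v ξ‖ ^ 2 + ell2 γ v * ‖ξ - Pv v ξ‖ ^ 2) ∧
    ∃ K > (0 : ℝ), ∀ v : V3, v ≠ 0 → ∀ ξ : V3,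
      K * (jap v ^ γ * ‖Pv v ξ‖ ^ 2 + jap v ^ (γ + 2) * ‖ξ - Pv v ξ‖ ^ 2)
        ≤ ∑ i, ∑ j, abar γ v i j * ξ i * ξ j := by
  have h₁ : -3 < γ + 2 := by linarith [hγ.1]
  have h₂ : γ + 2 < 0 := by linarith [hγ.2]
  refine ⟨fun v hv ξ => sum_abar_eq_ell h₁ h₂ hv ξ, lowerConst γ, lowerConst_pos γ,
    fun v hv ξ => ?_⟩
  rw [sum_abar_eq_ell h₁ h₂ hv, mul_add, ← mul_assoc, ← mul_assoc]
  gcongr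
  · exact lowerConst_mul_le_ell1 h₁ h₂ hv
  · exact lowerConst_mul_le_ell2 h₁ h₂ hv
end
end
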